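/- arXiv:2001.10237 — 3 statements merged into one kernel-verified Lean document; each statement's English description precedes it below -/
import Mathlib

section
/- Fix a coordinate index k with a_k ≠ 0 and assume additionally that S is Hermitian positive definite. Let c = a_k^H Σ(γ)^{-1} a_k and b = a_k^H Σ(γ)^{-1} S Σ(γ)^{-1} a_k; both are positive reals. Set δ = max{(b−c)/c², −γ_k} (so that γ + δ e_k ≥ 0 entrywise and 1 + δc ≥ b/c > 0) and define the reward r_k = bδ/(1+δc) − log(1+δc). Then F(γ + δ e_k) ≤ F(γ) − r_k. -/
open Matrix ComplexOrder

/-- The covariance matrix `Σ(γ) = Q diag(γ) Qᴴ + σ² I` of the massive-random-access model. -/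
noncomputable def covMat (L n : ℕ) (Q : Matrix (Fin L) (Fin n) ℂ) (σsq : ℝ)
    (γ : Fin n → ℝ) : Matrix (Fin L) (Fin L) ℂ :=
  Q * Matrix.diagonal (fun i => (γ i : ℂ)) * Qᴴ + (σsq : ℂ) • (1 : Matrix (Fin L) (Fin L) ℂ)

/-- The maximum-likelihood objective `F(γ) = log det Σ(γ) + Tr(Σ(γ)⁻¹ S)`. -/
noncomputable def mlObj (L n : ℕ) (Q : Matrix (Fin L) (Fin n) ℂ) (σsq : ℝ)
    (S : Matrix (Fin L) (Fin L) ℂ) (γ : Fin n → ℝ) : ℝ :=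
  Real.log ((covMat L n Q σsq γ).det.re) + ((covMat L n Q σsq γ)⁻¹ * S).trace.re

namespace Matrix

variable {m K : Type*} [Fintype m] [DecidableEq m] [Field K]

/-- The matrix determinant lemma for a scaled rank-one update. -/
theorem det_add_smul_vecMulVec {A : Matrix m m K} (hA : IsUnit A.det) (t : K) (u v : m → K) :
    (A + t • vecMulVec u v).det = A.det * (1 + t * (v ⬝ᵥ (A⁻¹ *ᵥ u))) := by
  rw [← smul_vecMulVec, vecMulVec_eq Unit, det_add_replicateCol_mul_replicateRow hA,
    det_unique (n := Unit), ← replicateRow_vecMul, Matrix.add_apply,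
    replicateRow_mul_replicateCol_apply, one_apply_eq, dotProduct_smul, dotProduct_mulVec,
    smul_eq_mul]

/-- The Sherman–Morrison formula. -/
theorem inv_add_smul_vecMulVec {A : Matrix m m K} (hA : IsUnit A.det) (t : K) (u v : m → K)
    (h : 1 + t * (v ⬝ᵥ (A⁻¹ *ᵥ u)) ≠ 0) :
    (A + t • vecMulVec u v)⁻¹ =
      A⁻¹ - (t / (1 + t * (v ⬝ᵥ (A⁻¹ *ᵥ u)))) • vecMulVec (A⁻¹ *ᵥ u) (v ᵥ* A⁻¹) := by
  apply inv_eq_right_inv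
  rw [Matrix.mul_sub, Matrix.add_mul, mul_nonsing_inv A hA, Matrix.smul_mul, vecMulVec_mul,
    Matrix.mul_smul, Matrix.add_mul, mul_vecMulVec, mulVec_mulVec, mul_nonsing_inv A hA,
    one_mulVec, Matrix.smul_mul, vecMulVec_mul_vecMulVec, vecMulVec_smul]
  set z := v ⬝ᵥ (A⁻¹ *ᵥ u)
  rw [sub_eq_iff_eq_add]
  congr 1
  match_scalars
  field_simp

end Matrix

theorem covMat_posDef {L n : ℕ} (Q : Matrix (Fin L) (Fin n) ℂ) {σsq : ℝ} (hσ : 0 < σsq)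
    {γ : Fin n → ℝ} (hγ : ∀ i, 0 ≤ γ i) : (covMat L n Q σsq γ).PosDef := by
  have h1 : (Q * diagonal (fun i => (γ i : ℂ)) * Qᴴ).PosSemidef :=
    (PosSemidef.diagonal (fun i => by simpa using hγ i)).mul_mul_conjTranspose_same Q
  exact PosDef.posSemidef_add h1 (PosDef.one.smul (by simpa using hσ))

/-- Incrementing one coordinate of `γ` is a rank-one update of the covariance matrix. -/
theorem covMat_update {L n : ℕ} (Q : Matrix (Fin L) (Fin n) ℂ) (σsq : ℝ)
    (γ : Fin n → ℝ) (k : Fin n) (δ : ℝ) :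
    covMat L n Q σsq (Function.update γ k (γ k + δ)) =
      covMat L n Q σsq γ + (δ : ℂ) • vecMulVec (Q.col k) (star (Q.col k)) := by
  have h : diagonal (fun i => (Function.update γ k (γ k + δ) i : ℂ)) =
      diagonal (fun i => (γ i : ℂ)) + (δ : ℂ) • diagonal (Pi.single k 1) := by
    rw [← diagonal_smul, diagonal_add]
    congr 1
    ext i
    obtain rfl | hi := eq_or_ne i k <;> simp [*]
  have h2 : Q * diagonal (Pi.single k (1 : ℂ)) * Qᴴ = vecMulVec (Q.col k) (star (Q.col k)) := by
    ext i j
    rw [Matrix.mul_apply]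
    simp [vecMulVec_apply, Matrix.mul_diagonal, Pi.single_apply]
  unfold covMat
  rw [h, Matrix.mul_add, Matrix.add_mul, Matrix.mul_smul, Matrix.smul_mul, h2]
  abel

/-- Lemma 1 of the paper: with `a_k` the `k`-th column of `Q` (assumed nonzero), `S` Hermitian
positive definite, `c = a_kᴴ Σ(γ)⁻¹ a_k > 0`, `b = a_kᴴ Σ(γ)⁻¹ S Σ(γ)⁻¹ a_k > 0`,
`δ = max{(b-c)/c², -γ_k}` and reward `r_k = bδ/(1+δc) - log(1+δc)`, the coordinate update
decreases the objective: `F(γ + δ e_k) ≤ F(γ) - r_k`. -/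
theorem stmt_0 (L n : ℕ) (hL : 0 < L) (hn : 0 < n)
    (Q : Matrix (Fin L) (Fin n) ℂ) (σsq : ℝ) (hσ : 0 < σsq)
    (S : Matrix (Fin L) (Fin L) ℂ) (hS : S.PosDef)
    (γ : Fin n → ℝ) (hγ : ∀ i, 0 ≤ γ i)
    (k : Fin n) (hak : (fun i => Q i k) ≠ 0) :
    let a : Fin L → ℂ := fun i => Q i k
    let c : ℝ := (star a ⬝ᵥ ((covMat L n Q σsq γ)⁻¹ *ᵥ a)).re
    let b : ℝ :=
      (star a ⬝ᵥ (((covMat L n Q σsq γ)⁻¹ * S * (covMat L n Q σsq γ)⁻¹) *ᵥ a)).re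
    let δ : ℝ := max ((b - c) / c ^ 2) (-(γ k))
    let r : ℝ := b * δ / (1 + δ * c) - Real.log (1 + δ * c)
    0 < c ∧ 0 < b ∧
      mlObj L n Q σsq S (Function.update γ k (γ k + δ)) ≤ mlObj L n Q σsq S γ - r := by
  intro a c b δ r
  set M := covMat L n Q σsq γ with hM
  have hMpd : M.PosDef := covMat_posDef Q hσ hγ
  have hMdet : 0 < M.det := hMpd.det_pos
  have hMunit : IsUnit M.det := hMdet.ne'.isUnit
  have hz : 0 < star a ⬝ᵥ (M⁻¹ *ᵥ a) := hMpd.inv.dotProduct_mulVec_pos hak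
  have hvec : star (M⁻¹ *ᵥ a) = star a ᵥ* M⁻¹ := by
    rw [star_mulVec, hMpd.inv.isHermitian.eq]
  have hua : M⁻¹ *ᵥ a ≠ 0 := fun h => by simp [h] at hz
  have hw : 0 < star a ⬝ᵥ ((M⁻¹ * S * M⁻¹) *ᵥ a) := by
    have := hS.dotProduct_mulVec_pos hua
    rwa [hvec, ← dotProduct_mulVec, mulVec_mulVec, mulVec_mulVec] at this
  have hc : 0 < c := (Complex.pos_iff.1 hz).1
  have hb : 0 < b := (Complex.pos_iff.1 hw).1
  have hzc : star a ⬝ᵥ (M⁻¹ *ᵥ a) = (c : ℂ) :=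
    Complex.ext rfl (by simpa using (Complex.pos_iff.1 hz).2.symm)
  have hwb : star a ⬝ᵥ ((M⁻¹ * S * M⁻¹) *ᵥ a) = (b : ℂ) :=
    Complex.ext rfl (by simpa using (Complex.pos_iff.1 hw).2.symm)
  have hd : 0 < 1 + δ * c := by
    have h1 : (b - c) / c ^ 2 * c ≤ δ * c :=
      mul_le_mul_of_nonneg_right (le_max_left _ _) hc.le
    have h2 : (b - c) / c ^ 2 * c = b / c - 1 := by field_simp
    have h3 : 0 < b / c := div_pos hb hc
    linarith
  have hdC : 1 + (δ : ℂ) * c ≠ 0 := by exact_mod_cast hd.ne'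
  refine ⟨hc, hb, le_of_eq ?_⟩
  have hdet : (M + (δ : ℂ) • vecMulVec a (star a)).det.re = M.det.re * (1 + δ * c) := by
    rw [det_add_smul_vecMulVec hMunit, hzc]
    norm_cast
    rw [Complex.re_mul_ofReal]
  have htr : ((M + (δ : ℂ) • vecMulVec a (star a))⁻¹ * S).trace.re =
      (M⁻¹ * S).trace.re - b * δ / (1 + δ * c) := by
    rw [inv_add_smul_vecMulVec hMunit _ _ _ (by rwa [hzc]), hzc, Matrix.sub_mul, trace_sub,
      Matrix.smul_mul, trace_smul, vecMulVec_mul, trace_vecMulVec, dotProduct_comm,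
      vecMul_vecMul, ← dotProduct_mulVec, mulVec_mulVec, hwb, Complex.sub_re]
    congr 1
    rw [smul_eq_mul]
    norm_cast
    ring
  have hup : covMat L n Q σsq (Function.update γ k (γ k + δ)) =
      M + (δ : ℂ) • vecMulVec a (star a) := covMat_update Q σsq γ k δ
  rw [mlObj, mlObj, hup, ← hM, hdet, htr,
    Real.log_mul (Complex.pos_iff.1 hMdet).1.ne' hd.ne']
  ring
end

section
/- Let b > 0 and c > 0 be reals and define g(d) = log(1 + c·d) − b·d/(1 + c·d) for d in the interval (−1/c, ∞). Then δ = (b − c)/c² lies in (−1/c, ∞), and g(δ) ≤ g(d) for every d ∈ (−1/c, ∞); that is, δ is the global minimizer of g on (−1/c, ∞). -/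
/-- The unconstrained step `δ = (b - c)/c²` is the global minimizer of
`g(d) = log(1 + c d) - b d / (1 + c d)` on the interval `(-1/c, ∞)`. -/
theorem stmt_3 (b c : ℝ) (hb : 0 < b) (hc : 0 < c) :
    (-(1 / c) < (b - c) / c ^ 2) ∧
    ∀ d : ℝ, -(1 / c) < d →
      Real.log (1 + c * ((b - c) / c ^ 2)) -
          b * ((b - c) / c ^ 2) / (1 + c * ((b - c) / c ^ 2)) ≤
        Real.log (1 + c * d) - b * d / (1 + c * d) := by
  have hδ : 1 + c * ((b - c) / c ^ 2) = b / c := by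
    field_simp
    ring
  refine ⟨?_, fun d hd => ?_⟩
  · have h : (b - c) / c ^ 2 = b / c ^ 2 - 1 / c := by field_simp
    have : 0 < b / c ^ 2 := by positivity
    linarith
  · have ht : 0 < 1 + c * d := by
      have h := mul_lt_mul_of_pos_left hd hc
      have h' : c * -(1 / c) = -1 := by field_simp
      linarith
    have hr : 0 < b / c := by positivity
    have hlog := Real.log_le_sub_one_of_pos (div_pos hr ht)
    rw [Real.log_div hr.ne' ht.ne'] at hlog
    have hleft : b * ((b - c) / c ^ 2) / (b / c) = b / c - 1 := by field_simp
    have hright : b * d / (1 + c * d) = b / c - b / c / (1 + c * d) := by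
      rw [div_eq_iff ht.ne', sub_mul, div_mul_cancel₀ _ ht.ne']
      field_simp
      ring
    rw [hδ, hleft, hright]
    linarith
end

section
/- Let n ≥ 1 be an integer. For each t ∈ ℕ let r_{t,1},…,r_{t,n} be nonnegative reals with Σ_{ℓ=1}^n r_{t,ℓ} > 0, and let (ε_t)_{t≥0} be nonnegative reals with ε_0 > 0 such that for every t: ε_{t+1} ≤ ε_t − max_{k∈[n]} r_{t,k} and ε_t ≤ Σ_{ℓ=1}^n r_{t,ℓ}. Let η > 0 and let t₀ be a natural number with t₀ ≥ 1 and t₀ ≥ n·log(n·ε_0/η²). Then for every integer t ≥ t₀, ε_t ≤ η²/(n + t − t₀). -/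
/-- The sum of a real family over `Fin n` is at most `n` times its maximum. -/
lemma sum_le_card_mul_sup' {n : ℕ} (h : (Finset.univ : Finset (Fin n)).Nonempty)
    (f : Fin n → ℝ) : ∑ i, f i ≤ (n : ℝ) * Finset.univ.sup' h f := by
  simpa using Finset.sum_le_card_nsmul Finset.univ f (Finset.univ.sup' h f)
    fun i hi => Finset.le_sup' f hi

/-- A sequence contracting by the factor `1 - 1 / a` decays at least like `exp (-t / a)`. -/
lemma le_mul_exp_of_contraction {ε : ℕ → ℝ} {a : ℝ} (hε : ∀ t, 0 ≤ ε t)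
    (hc : ∀ t, ε (t + 1) ≤ (1 - 1 / a) * ε t) (t : ℕ) :
    ε t ≤ ε 0 * Real.exp (-(t / a)) := by
  induction t with
  | zero => simp
  | succ t ih =>
    calc ε (t + 1) ≤ (1 - 1 / a) * ε t := hc t
      _ ≤ Real.exp (-(1 / a)) * ε t := by
        gcongr
        · exact hε t
        · exact Real.one_sub_le_exp_neg (1 / a)
      _ ≤ Real.exp (-(1 / a)) * (ε 0 * Real.exp (-(t / a))) := by gcongr
      _ = ε 0 * Real.exp (-((t + 1 : ℕ) / a)) := by
        rw [mul_left_comm, ← Real.exp_add]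
        push_cast
        ring_nf

/-- For `0 < a ≤ m` and `0 ≤ c`, contracting `c / m` by the factor `1 - 1 / a` gives at most `c / (m + 1)`. -/
lemma one_sub_one_div_mul_div_le {a m c : ℝ} (ha : 0 < a) (ham : a ≤ m) (hc : 0 ≤ c) :
    (1 - 1 / a) * (c / m) ≤ c / (m + 1) := by
  have hm : 0 < m := ha.trans_le ham
  have h : (1 - 1 / a) * (m + 1) ≤ m := by
    have : 1 ≤ 1 / a * (m + 1) := by
      rw [one_div_mul_eq_div, one_le_div ha]
      linarith
    linarith
  rw [← mul_div_assoc, div_le_div_iff₀ hm (by linarith)]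
  linarith [mul_le_mul_of_nonneg_left h hc]

/-- Theorem 4 of the paper (O(1/t) convergence of greedy coordinate descent). -/
theorem stmt_8 (n : ℕ) (hn : 0 < n)
    (r : ℕ → Fin n → ℝ) (hr : ∀ t k, 0 ≤ r t k)
    (hpos : ∀ t, 0 < ∑ ℓ, r t ℓ)
    (ε : ℕ → ℝ) (hε : ∀ t, 0 ≤ ε t) (hε0 : 0 < ε 0)
    (hstep : ∀ t, ε (t + 1) ≤ ε t -
      Finset.univ.sup' (Finset.univ_nonempty_iff.mpr (Fin.pos_iff_nonempty.mp hn)) (r t))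
    (hub : ∀ t, ε t ≤ ∑ ℓ, r t ℓ)
    (η : ℝ) (hη : 0 < η)
    (t₀ : ℕ) (ht₀1 : 1 ≤ t₀)
    (ht₀ : (n : ℝ) * Real.log ((n : ℝ) * ε 0 / η ^ 2) ≤ (t₀ : ℝ)) :
    ∀ t : ℕ, t₀ ≤ t → ε t ≤ η ^ 2 / ((n : ℝ) + (t : ℝ) - (t₀ : ℝ)) := by
  have hn' : (0 : ℝ) < n := by exact_mod_cast hn
  have hc : ∀ t, ε (t + 1) ≤ (1 - 1 / (n : ℝ)) * ε t := by
    intro t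
    have hmax := (hub t).trans (sum_le_card_mul_sup'
      (Finset.univ_nonempty_iff.mpr (Fin.pos_iff_nonempty.mp hn)) (r t))
    have hdiv := (div_le_iff₀' hn').mpr hmax
    calc ε (t + 1) ≤ ε t - ε t / n := (hstep t).trans (sub_le_sub_left hdiv _)
      _ = (1 - 1 / (n : ℝ)) * ε t := by ring
  have hone : (1 : ℝ) ≤ n := by exact_mod_cast hn
  have hcoef : 0 ≤ 1 - 1 / (n : ℝ) := sub_nonneg.mpr ((div_le_one hn').mpr hone)
  intro t ht
  induction t, ht using Nat.le_induction with
  | base =>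
    have hexp : (n : ℝ) * ε 0 / η ^ 2 ≤ Real.exp (t₀ / n) :=
      (Real.log_le_iff_le_exp (by positivity)).mp ((le_div_iff₀' hn').mpr ht₀)
    rw [div_le_iff₀ (by positivity)] at hexp
    rw [add_sub_cancel_right, le_div_iff₀' hn']
    calc (n : ℝ) * ε t₀ ≤ n * (ε 0 * Real.exp (-(t₀ / n))) := by
          gcongr
          exact le_mul_exp_of_contraction hε hc t₀
      _ = n * ε 0 * Real.exp (-(t₀ / n)) := by ring
      _ ≤ Real.exp (t₀ / n) * η ^ 2 * Real.exp (-(t₀ / n)) := by gcongr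
      _ = η ^ 2 := by rw [mul_right_comm, ← Real.exp_add, add_neg_cancel, Real.exp_zero, one_mul]
  | succ t ht ih =>
    have ht' : (t₀ : ℝ) ≤ t := by exact_mod_cast ht
    calc ε (t + 1) ≤ (1 - 1 / (n : ℝ)) * ε t := hc t
      _ ≤ (1 - 1 / (n : ℝ)) * (η ^ 2 / (n + t - t₀)) := by gcongr
      _ ≤ η ^ 2 / (n + t - t₀ + 1) :=
        one_sub_one_div_mul_div_le hn' (by linarith) (sq_nonneg η)
      _ = η ^ 2 / (n + (t + 1 : ℕ) - t₀) := by
        push_cast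
        ring_nf
end
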